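/- Let Ξ = (ξ_1, …, ξ_{m}) be a nondecreasing knot vector and let p ≥ 1. For every index a and every ξ lying in the interior of a knot span (i.e. ξ ∈ (ξ_i, ξ_{i+1}) for some i with ξ_i < ξ_{i+1}), the B-spline basis function N_{a,p} is differentiable at ξ and its derivative satisfies d/dξ N_{a,p}(ξ) = (p/(ξ_{a+p} − ξ_a)) · N_{a,p−1}(ξ) − (p/(ξ_{a+p+1} − ξ_{a+1})) · N_{a+1,p−1}(ξ), where any term whose denominator vanishes is taken to be zero. -/

import Mathlib

/-- Cox–de Boor recursion for B-spline basis functions. `bspline Ξ a p ξ` is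
`N_{a,p}(ξ)` (0-based indexing of knots and basis functions); any term whose
denominator vanishes is taken to be zero. -/
noncomputable def bspline (Ξ : ℕ → ℝ) : ℕ → ℕ → ℝ → ℝ
  | a, 0, ξ => if Ξ a ≤ ξ ∧ ξ < Ξ (a + 1) then 1 else 0
  | a, p + 1, ξ =>
      (if Ξ (a + p + 1) = Ξ a then 0
        else (ξ - Ξ a) / (Ξ (a + p + 1) - Ξ a) * bspline Ξ a p ξ) +
      (if Ξ (a + p + 2) = Ξ (a + 1) then 0
        else (Ξ (a + p + 2) - ξ) / (Ξ (a + p + 2) - Ξ (a + 1)) * bspline Ξ (a + 1) p ξ)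

/-- The Cox–de Boor recursion with the degenerate terms absorbed by `0⁻¹ = 0`. -/
lemma bspline_succ (Ξ : ℕ → ℝ) (a p : ℕ) (ξ : ℝ) :
    bspline Ξ a (p + 1) ξ =
      (ξ - Ξ a) * (Ξ (a + p + 1) - Ξ a)⁻¹ * bspline Ξ a p ξ +
        (Ξ (a + p + 2) - ξ) * (Ξ (a + p + 2) - Ξ (a + 1))⁻¹ * bspline Ξ (a + 1) p ξ := by
  rw [bspline]
  congr 1 <;> split_ifs with h <;> simp [h, div_eq_mul_inv]

/-- Degree-zero B-splines are locally constant on the interior of knot spans. -/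
lemma bspline_zero_hasDerivAt {Ξ : ℕ → ℝ} (hΞ : Monotone Ξ) (a : ℕ) {ξ : ℝ} {i : ℕ}
    (hlo : Ξ i < ξ) (hhi : ξ < Ξ (i + 1)) : HasDerivAt (bspline Ξ a 0) 0 ξ := by
  refine (hasDerivAt_const ξ (if a = i then (1 : ℝ) else 0)).congr_of_eventuallyEq ?_
  filter_upwards [Ioo_mem_nhds hlo hhi] with x hx
  rw [bspline]
  refine if_congr ⟨fun h => ?_, ?_⟩ rfl rfl
  · have h₁ : a < i + 1 := hΞ.reflect_lt (h.1.trans_lt hx.2)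
    have h₂ : i < a + 1 := hΞ.reflect_lt (hx.1.trans h.2)
    omega
  · rintro rfl
    exact ⟨hx.1.le, hx.2⟩

/-- If the knot interval `[Ξ (a + 1), Ξ b]` is nondegenerate, then so are the intervals
obtained from it by adding one knot on either side. -/
lemma inv_knot_sub_mul_eq_zero {Ξ : ℕ → ℝ} (hΞ : Monotone Ξ) {a b : ℕ} (hab : a + 1 ≤ b) :
    (Ξ b - Ξ (a + 1))⁻¹ *
      ((Ξ b - Ξ a) * (Ξ b - Ξ a)⁻¹ -
        (Ξ (b + 1) - Ξ (a + 1)) * (Ξ (b + 1) - Ξ (a + 1))⁻¹) = 0 := by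
  rcases (hΞ hab).eq_or_lt with h | h
  · simp [h]
  · have h₁ : Ξ b - Ξ a ≠ 0 := (sub_pos.2 ((hΞ a.le_succ).trans_lt h)).ne'
    have h₂ : Ξ (b + 1) - Ξ (a + 1) ≠ 0 := (sub_pos.2 (h.trans_le (hΞ b.le_succ))).ne'
    rw [mul_inv_cancel₀ h₁, mul_inv_cancel₀ h₂, sub_self, mul_zero]

/-- The B-spline derivative formula with the degenerate terms absorbed by `0⁻¹ = 0`. -/
lemma bspline_hasDerivAt_inv {Ξ : ℕ → ℝ} (hΞ : Monotone Ξ) (p a : ℕ) {ξ : ℝ} {i : ℕ}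
    (hlo : Ξ i < ξ) (hhi : ξ < Ξ (i + 1)) :
    HasDerivAt (bspline Ξ a p)
      (p * ((Ξ (a + p) - Ξ a)⁻¹ * bspline Ξ a (p - 1) ξ -
        (Ξ (a + p + 1) - Ξ (a + 1))⁻¹ * bspline Ξ (a + 1) (p - 1) ξ)) ξ := by
  induction p generalizing a with
  | zero => simpa using bspline_zero_hasDerivAt hΞ a hlo hhi
  | succ p ih =>
    have hl := (((hasDerivAt_id ξ).sub_const (Ξ a)).mul_const
      (Ξ (a + p + 1) - Ξ a)⁻¹).mul (ih a)
    have hr := (((hasDerivAt_id ξ).const_sub (Ξ (a + p + 2))).mul_const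
      (Ξ (a + p + 2) - Ξ (a + 1))⁻¹).mul (ih (a + 1))
    refine ((hl.add hr).congr_of_eventuallyEq
      (Filter.Eventually.of_forall (bspline_succ Ξ a p))).congr_deriv ?_
    cases p with
    | zero => simp; ring
    | succ q =>
      have key := inv_knot_sub_mul_eq_zero hΞ (a := a) (b := a + q + 2) (by omega)
      have h₁ := bspline_succ Ξ a q ξ
      have h₂ := bspline_succ Ξ (a + 1) q ξ
      have e₁ : a + (q + 1) = a + q + 1 := rfl
      have e₂ : a + 1 + q = a + q + 1 := by omega
      have e₃ : a + 1 + (q + 1) = a + q + 2 := by omega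
      simp only [Nat.add_sub_cancel, id, e₁, e₂, e₃, add_assoc (a + q), Nat.reduceAdd,
        Nat.cast_add, Nat.cast_one] at key h₁ h₂ ⊢
      rw [h₁, h₂]
      linear_combination (-(q + 1 : ℝ) * bspline Ξ (a + 1) q ξ) * key

/-- On the interior of any knot span, the derivative of a B-spline basis function of
degree `p ≥ 1` is given by
`N'_{a,p} = p/(ξ_{a+p} − ξ_a) N_{a,p−1} − p/(ξ_{a+p+1} − ξ_{a+1}) N_{a+1,p−1}`,
where a term with vanishing denominator is taken to be zero. -/
theorem bspline_hasDerivAt (Ξ : ℕ → ℝ) (hΞ : Monotone Ξ) (p : ℕ) (hp : 1 ≤ p)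
    (a : ℕ) (ξ : ℝ) (i : ℕ) (hlo : Ξ i < ξ) (hhi : ξ < Ξ (i + 1)) :
    HasDerivAt (bspline Ξ a p)
      ((if Ξ (a + p) = Ξ a then 0
          else (p : ℝ) / (Ξ (a + p) - Ξ a) * bspline Ξ a (p - 1) ξ) -
        (if Ξ (a + p + 1) = Ξ (a + 1) then 0
          else (p : ℝ) / (Ξ (a + p + 1) - Ξ (a + 1)) * bspline Ξ (a + 1) (p - 1) ξ)) ξ := by
  obtain ⟨p, rfl⟩ := Nat.exists_eq_add_of_le' hp
  refine (bspline_hasDerivAt_inv hΞ (p + 1) a hlo hhi).congr_deriv ?_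
  rw [mul_sub]
  congr 1 <;> split_ifs with h <;> simp [h, div_eq_mul_inv, mul_assoc]
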